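/- For every dilation δ and every translation σ ≠ id of an affine plane, the translations σ and δ⁻¹ ∘ σ ∘ δ have the same direction. -/

import Mathlib

/-- An affine plane: a type `P` of points together with a set of subsets of `P`
(the lines) satisfying the three axioms of affine planes. -/
structure AffinePlane (P : Type*) where
  lines : Set (Set P)
  /-- A1: any two distinct points lie on exactly one line. -/
  a1 : ∀ A B : P, A ≠ B → ∃! ℓ : Set P, ℓ ∈ lines ∧ A ∈ ℓ ∧ B ∈ ℓ
  /-- A2: for a point `A` not on a line `ℓ` there is exactly one line through `A`
  disjoint from `ℓ`. -/
  a2 : ∀ (A : P) (ℓ : Set P), ℓ ∈ lines → A ∉ ℓ →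
    ∃! m : Set P, m ∈ lines ∧ A ∈ m ∧ m ∩ ℓ = ∅
  /-- A3: there are three points not all on one line. -/
  a3 : ∃ A B C : P, ∀ ℓ ∈ lines, ¬(A ∈ ℓ ∧ B ∈ ℓ ∧ C ∈ ℓ)

namespace AffinePlane

variable {P : Type*}

/-- Two lines are parallel if they are equal or disjoint. -/
def Parallel (π : AffinePlane P) (ℓ m : Set P) : Prop :=
  ℓ = m ∨ ℓ ∩ m = ∅

/-- A collineation is a bijection of the points mapping lines to lines. -/
def IsCollineation (π : AffinePlane P) (f : P ≃ P) : Prop :=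
  ∀ ℓ ∈ π.lines, f '' ℓ ∈ π.lines

/-- A dilation is a collineation `f` such that for all distinct points `A`, `B`,
the line through `f A` and `f B` is parallel to the line through `A` and `B`. -/
def IsDilation (π : AffinePlane P) (f : P ≃ P) : Prop :=
  IsCollineation π f ∧
  ∀ A B : P, A ≠ B → ∀ ℓ m : Set P,
    (ℓ ∈ π.lines ∧ f A ∈ ℓ ∧ f B ∈ ℓ) →
    (m ∈ π.lines ∧ A ∈ m ∧ B ∈ m) →
    Parallel π ℓ m

/-- A translation is a dilation which is the identity or has no fixed point. -/
def IsTranslation (π : AffinePlane P) (f : P ≃ P) : Prop :=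
  IsDilation π f ∧ (f = Equiv.refl P ∨ ∀ A : P, f A ≠ A)

/-- Two translations `σ`, `τ` have the same direction: for all points `A`, `B`,
the line through `A` and `σ A` is parallel to the line through `B` and `τ B`. -/
def SameDirection (π : AffinePlane P) (σ τ : P ≃ P) : Prop :=
  ∀ (A B : P) (ℓ m : Set P),
    ℓ ∈ π.lines → A ∈ ℓ → σ A ∈ ℓ →
    m ∈ π.lines → B ∈ m → τ B ∈ m →
    Parallel π ℓ m

theorem eq_of_mem (π : AffinePlane P) {A B : P} (h : A ≠ B) {ℓ m : Set P}
    (hℓ : ℓ ∈ π.lines) (hAℓ : A ∈ ℓ) (hBℓ : B ∈ ℓ)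
    (hm : m ∈ π.lines) (hAm : A ∈ m) (hBm : B ∈ m) : ℓ = m :=
  (π.a1 A B h).unique ⟨hℓ, hAℓ, hBℓ⟩ ⟨hm, hAm, hBm⟩

theorem Parallel.eq_of_common_point {π : AffinePlane P} {ℓ m : Set P} (h : Parallel π ℓ m)
    {X : P} (hℓ : X ∈ ℓ) (hm : X ∈ m) : ℓ = m :=
  h.resolve_right fun he => (Set.ext_iff.1 he X).1 ⟨hℓ, hm⟩

theorem parallel_of_common_point {π : AffinePlane P} {ℓ m : Set P}
    (h : ∀ X, X ∈ ℓ → X ∈ m → ℓ = m) : Parallel π ℓ m := by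
  by_cases he : (ℓ ∩ m).Nonempty
  · obtain ⟨X, hX⟩ := he
    exact Or.inl (h X hX.1 hX.2)
  · exact Or.inr (Set.not_nonempty_iff_eq_empty.1 he)

theorem Parallel.symm {π : AffinePlane P} {ℓ m : Set P} (h : Parallel π ℓ m) :
    Parallel π m ℓ :=
  parallel_of_common_point fun _ hm hℓ => (h.eq_of_common_point hℓ hm).symm

theorem Parallel.trans {π : AffinePlane P} {ℓ n m : Set P}
    (hℓ : ℓ ∈ π.lines) (hn : n ∈ π.lines) (hm : m ∈ π.lines)
    (h₁ : Parallel π ℓ n) (h₂ : Parallel π n m) : Parallel π ℓ m := by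
  refine parallel_of_common_point fun X hXℓ hXm => ?_
  by_cases hX : X ∈ n
  · exact (h₁.eq_of_common_point hXℓ hX).trans (h₂.eq_of_common_point hX hXm)
  · have e₁ : ℓ ∩ n = ∅ := h₁.resolve_left fun e => hX (e ▸ hXℓ)
    have e₂ : m ∩ n = ∅ := h₂.symm.resolve_left fun e => hX (e ▸ hXm)
    exact (π.a2 X n hn hX).unique ⟨hℓ, hXℓ, e₁⟩ ⟨hm, hXm, e₂⟩

/-- A line containing a point and its image under a dilation is mapped into itself. -/
theorem IsDilation.map_mem {π : AffinePlane P} {σ : P ≃ P} (hσ : IsDilation π σ)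
    {A X : P} {ℓ : Set P} (hℓ : ℓ ∈ π.lines) (hA : A ∈ ℓ) (hσA : σ A ∈ ℓ) (hX : X ∈ ℓ) :
    σ X ∈ ℓ := by
  rcases eq_or_ne A X with rfl | h
  · exact hσA
  · obtain ⟨k, ⟨hk, hAk, hXk⟩, -⟩ := π.a1 (σ A) (σ X) (σ.injective.ne h)
    have hp := hσ.2 A X h k ℓ ⟨hk, hAk, hXk⟩ ⟨hℓ, hA, hX⟩
    exact hp.eq_of_common_point hAk hσA ▸ hXk

/-- A fixed-point-free dilation has the same direction as itself. -/
theorem IsDilation.sameDirection_self {π : AffinePlane P} {σ : P ≃ P} (hσ : IsDilation π σ)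
    (hfix : ∀ A, σ A ≠ A) : SameDirection π σ σ :=
  fun _ _ _ _ hℓ hA hσA hm hB hσB => parallel_of_common_point fun X hXℓ hXm =>
    π.eq_of_mem (hfix X).symm hℓ hXℓ (hσ.map_mem hℓ hA hσA hXℓ)
      hm hXm (hσ.map_mem hm hB hσB hXm)

/-- For every dilation `δ` and translation `σ ≠ id`, the translations `σ` and
`δ⁻¹ ∘ σ ∘ δ` have the same direction. -/
theorem conjugate_same_direction (π : AffinePlane P)
    (δ σ : P ≃ P) (hδ : IsDilation π δ) (hσ : IsTranslation π σ)
    (hne : σ ≠ Equiv.refl P) :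
    SameDirection π σ ((δ.trans σ).trans δ.symm) := by
  have hfix := hσ.2.resolve_left hne
  intro A B ℓ m hℓ hA hσA hm hB hτB
  have hδτ : δ (((δ.trans σ).trans δ.symm) B) = σ (δ B) := by simp
  have hBτ : B ≠ ((δ.trans σ).trans δ.symm) B := fun h =>
    hfix (δ B) (hδτ.symm.trans (congrArg δ h).symm)
  obtain ⟨n, ⟨hn, hBn, hσn⟩, -⟩ := π.a1 (δ B) (σ (δ B)) (hfix (δ B)).symm
  exact Parallel.trans hℓ hn hm
    (hσ.1.sameDirection_self hfix A (δ B) ℓ n hℓ hA hσA hn hBn hσn)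
    (hδ.2 B _ hBτ n m ⟨hn, hBn, hδτ.symm ▸ hσn⟩ ⟨hm, hB, hτB⟩)

end AffinePlane
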